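/- arXiv:2103.09018 — 4 statements merged into one kernel-verified Lean document; each statement's English description precedes it below -/
import Mathlib

section
/- Let N be a prime number and let α, β ∈ (0,1) both be irrational. Then the Veech N-example T_f is NOT minimal if and only if there exist integers m and n, both divisible by N, such that β = mα + n. -/
open Set

noncomputable section

/-- The rotation of angle `α` on `[0,1)`: `x ↦ x + α mod 1`. -/
def rot (α : ℝ) (x : ℝ) : ℝ := Int.fract (x + α)

/-- The skew product `T_f(x,s) = (Tx, s + f(x))` on `[0,1) × ℤ/Nℤ`. -/
def skew {N : ℕ} (T : ℝ → ℝ) (f : ℝ → ZMod N) : ℝ × ZMod N → ℝ × ZMod N :=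
  fun p => (T p.1, p.2 + f p.1)

/-- Minimality of the skew product on `[0,1) × ℤ/Nℤ`, where `[0,1)` carries the topology of
the circle `ℝ/ℤ` (distances being measured in `AddCircle 1`) and `ℤ/Nℤ` is discrete:
every forward orbit is dense. -/
def MinimalExt {N : ℕ} (T : ℝ → ℝ) (f : ℝ → ZMod N) : Prop :=
  ∀ x ∈ Ico (0:ℝ) 1, ∀ s : ZMod N, ∀ y ∈ Ico (0:ℝ) 1, ∀ u : ZMod N, ∀ ε > 0, ∃ n : ℕ,
    dist (((skew T f)^[n] (x, s)).1 : AddCircle (1:ℝ)) (y : AddCircle (1:ℝ)) < ε ∧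
    ((skew T f)^[n] (x, s)).2 = u

/-- The step function of the Veech N-example: `f = 1` on `[0,β)` and `f = 0` on `[β,1)`. -/
def veechf (N : ℕ) (β : ℝ) (x : ℝ) : ZMod N := if x < β then 1 else 0

open Filter Topology

/-- Every forward orbit of an irrational rotation enters every interval modulo `1`. -/
theorem exists_nat_int_mem_Ico {α : ℝ} (hα : Irrational α) (x y : ℝ) {ε : ℝ} (hε : 0 < ε) :
    ∃ (n : ℕ) (p : ℤ), y ≤ x + n * α + p ∧ x + n * α + p < y + ε := by
  have hd : DenseRange (· • (α : AddCircle (1 : ℝ)) : ℕ → AddCircle (1 : ℝ)) := by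
    rw [← denseRange_zsmul_iff_nsmul, AddCircle.denseRange_zsmul_coe_iff]
    simpa using hα
  obtain ⟨n, hn⟩ := hd.exists_dist_lt ((y - x + ε / 2 : ℝ) : AddCircle (1 : ℝ)) (half_pos hε)
  have hcoe : n • (α : AddCircle (1 : ℝ)) = ((n * α : ℝ) : AddCircle (1 : ℝ)) := by
    rw [← nsmul_eq_mul, AddCircle.coe_nsmul]
  rw [hcoe, dist_eq_norm, ← AddCircle.coe_sub, UnitAddCircle.norm_eq, abs_lt] at hn
  exact ⟨n, round (y - x + ε / 2 - n * α), by linarith [hn.2], by linarith [hn.1]⟩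

theorem eventually_floor_add_eq (x : ℝ) : ∀ᶠ η in 𝓝[≥] (0 : ℝ), ⌊x + η⌋ = ⌊x⌋ := by
  have h : 0 < 1 - Int.fract x := by linarith [Int.fract_lt_one x]
  filter_upwards [Ico_mem_nhdsGE h] with η hη
  rw [Int.floor_eq_iff]
  have := Int.floor_add_fract x
  exact ⟨by linarith [hη.1, Int.fract_nonneg x], by linarith [hη.2]⟩

theorem eventually_floor_sub_eq {x : ℝ} (hx : ∀ k : ℤ, x ≠ k) :
    ∀ᶠ η in 𝓝[>] (0 : ℝ), ⌊x - η⌋ = ⌊x⌋ := by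
  have h : 0 < Int.fract x := by
    rw [Int.fract_pos]
    exact hx _
  filter_upwards [Ioo_mem_nhdsGT h] with η hη
  rw [Int.floor_eq_iff]
  have := Int.floor_add_fract x
  exact ⟨by linarith [hη.2], by linarith [hη.1, Int.fract_lt_one x]⟩

theorem eventually_floor_intCast_sub (k : ℤ) :
    ∀ᶠ η in 𝓝[>] (0 : ℝ), ⌊(k : ℝ) - η⌋ = k - 1 := by
  filter_upwards [Ioo_mem_nhdsGT (zero_lt_one' ℝ)] with η hη
  rw [Int.floor_eq_iff]
  push_cast
  exact ⟨by linarith [hη.2], by linarith [hη.1]⟩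

/-- The `1`-periodic extension to `ℝ` of the indicator function of `[0,β)`. -/
def arcCount (β x : ℝ) : ℤ := ⌊x⌋ - ⌊x - β⌋

theorem veechf_fract (N : ℕ) {β : ℝ} (hβ : β ∈ Ioo (0 : ℝ) 1) (x : ℝ) :
    veechf N β (Int.fract x) = (arcCount β x : ZMod N) := by
  have h0 := Int.fract_nonneg x
  have h1 := Int.fract_lt_one x
  have h2 := Int.floor_add_fract x
  unfold veechf arcCount
  split_ifs with h
  · have : ⌊x - β⌋ = ⌊x⌋ - 1 := by
      rw [Int.floor_eq_iff]
      push_cast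
      exact ⟨by linarith [hβ.2], by linarith⟩
    rw [this]
    simp
  · have : ⌊x - β⌋ = ⌊x⌋ := by
      rw [Int.floor_eq_iff]
      exact ⟨by linarith, by linarith [hβ.1]⟩
    rw [this]
    simp

theorem arcCount_add_intCast (β x : ℝ) (p : ℤ) : arcCount β (x + p) = arcCount β x := by
  unfold arcCount
  rw [add_sub_right_comm, Int.floor_add_intCast, Int.floor_add_intCast]
  ring

theorem eventually_arcCount_add_eq (β x : ℝ) :
    ∀ᶠ η in 𝓝[≥] (0 : ℝ), arcCount β (x + η) = arcCount β x := by
  filter_upwards [eventually_floor_add_eq x, eventually_floor_add_eq (x - β)] with η h1 h2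
  rw [arcCount, arcCount, h1, add_sub_right_comm, h2]

theorem skew_iterate (N : ℕ) (α : ℝ) {β : ℝ} (hβ : β ∈ Ioo (0 : ℝ) 1) {x : ℝ}
    (hx : x ∈ Ico (0 : ℝ) 1) (s : ZMod N) (n : ℕ) :
    (skew (rot α) (veechf N β))^[n] (x, s) =
      (Int.fract (x + n * α),
        s + ∑ i ∈ Finset.range n, (arcCount β (x + i * α) : ZMod N)) := by
  induction n with
  | zero => simp [Int.fract_eq_self.2 hx]
  | succ n ih =>
    rw [Function.iterate_succ_apply', ih, skew]
    simp only [rot, veechf_fract N hβ, Finset.sum_range_succ, ← add_assoc]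
    congr 1
    rw [Int.fract_eq_fract]
    refine ⟨-⌊x + n * α⌋, ?_⟩
    have := Int.floor_add_fract (x + n * α)
    push_cast
    linarith

/-- If the orbit of `x₀` under the skew product over `x ↦ x + α` avoids some `[y,y+ε) × {u}`,
then the cocycle `f` is the coboundary of a function that is constant on some interval. -/
theorem exists_transfer_of_avoid {N : ℕ} [Fact N.Prime] {α : ℝ} (hα : Irrational α)
    {f : ℝ → ZMod N} (hper : ∀ (x : ℝ) (p : ℤ), f (x + p) = f x)
    (hright : ∀ x, ∀ᶠ η in 𝓝[≥] (0 : ℝ), f (x + η) = f x)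
    {x₀ y₁ ε₁ : ℝ} {u₁ : ZMod N} (hε₁ : 0 < ε₁)
    (havoid : ∀ (n : ℕ) (p : ℤ), y₁ ≤ x₀ + n * α + p → x₀ + n * α + p < y₁ + ε₁ →
      ∑ i ∈ Finset.range n, f (x₀ + i * α) ≠ u₁) :
    ∃ (F : ℝ → ZMod N) (y₀ δ : ℝ), 0 < δ ∧ (∀ z, y₀ ≤ z → z < y₀ + δ → F z = F y₀) ∧
      (∀ x, F (x + 1) = F x) ∧ ∀ x, F (x + α) = F x + f x := by
  classical
  set P : ℕ → ZMod N := fun n => ∑ i ∈ Finset.range n, f (x₀ + i * α)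
  set V : ℝ → ℝ → ZMod N → Prop := fun y ε u =>
    ∃ (n : ℕ) (p : ℤ), y ≤ x₀ + n * α + p ∧ x₀ + n * α + p < y + ε ∧ P n = u
  set S : ℝ → Finset (ZMod N) := fun y => Finset.univ.filter fun u => ∀ ε > 0, V y ε u with hS
  have memS : ∀ y u, u ∈ S y ↔ ∀ ε > 0, V y ε u := by simp [hS]
  -- near `y` from the right, only the values in `S y` are visited
  have hgap : ∀ y, ∃ δ > 0, ∀ u, V y δ u → u ∈ S y := by
    intro y
    have : ∀ u, ∃ ε > 0, V y ε u → u ∈ S y := by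
      intro u
      by_cases hu : u ∈ S y
      · exact ⟨1, one_pos, fun _ => hu⟩
      · have h := hu
        rw [memS] at h
        push Not at h
        obtain ⟨ε, hε, h⟩ := h
        exact ⟨ε, hε, fun h' => absurd h' h⟩
    choose e he hVe using this
    obtain ⟨w, -, hw⟩ := Finset.exists_min_image Finset.univ e Finset.univ_nonempty
    refine ⟨e w, he w, fun u hu => hVe u ?_⟩
    obtain ⟨n, p, h1, h2, h3⟩ := hu
    exact ⟨n, p, h1, by linarith [hw u (Finset.mem_univ u)], h3⟩
  have hsub : ∀ y, ∃ δ > 0, ∀ z, y ≤ z → z < y + δ → S z ⊆ S y := by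
    intro y
    obtain ⟨δ, hδ, h⟩ := hgap y
    refine ⟨δ, hδ, fun z hz hz' u hu => h u ?_⟩
    obtain ⟨n, p, h1, h2, h3⟩ := (memS z u).1 hu (y + δ - z) (by linarith)
    exact ⟨n, p, by linarith, by linarith, h3⟩
  have hne : ∀ y, (S y).Nonempty := by
    intro y
    obtain ⟨δ, hδ, h⟩ := hgap y
    obtain ⟨n, p, h1, h2⟩ := exists_nat_int_mem_Ico hα x₀ y hδ
    exact ⟨P n, h _ ⟨n, p, h1, h2, rfl⟩⟩
  have hSint : ∀ y (q : ℤ), S y ⊆ S (y + q) := by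
    intro y q u hu
    rw [memS] at hu ⊢
    intro ε hε
    obtain ⟨n, p, h1, h2, h3⟩ := hu ε hε
    exact ⟨n, p + q, by push_cast; linarith, by push_cast; linarith, h3⟩
  have hforward : ∀ y, (S y).image (· + f y) ⊆ S (y + α) := by
    intro y v hv
    obtain ⟨u, hu, rfl⟩ := Finset.mem_image.1 hv
    rw [memS] at hu ⊢
    intro ε hε
    obtain ⟨δ, hδ, hfδ⟩ := mem_nhdsGE_iff_exists_Ico_subset.1 (hright y)
    obtain ⟨n, p, h1, h2, h3⟩ := hu (min ε δ) (lt_min hε hδ)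
    have := min_le_left ε δ
    have := min_le_right ε δ
    refine ⟨n + 1, p, by push_cast; linarith, by push_cast; linarith, ?_⟩
    have hf : f (y + (x₀ + n * α + p - y)) = f y :=
      hfδ ⟨by linarith, by linarith⟩
    rw [add_sub_cancel, hper] at hf
    rw [← hf, ← h3]
    exact Finset.sum_range_succ _ n
  have hcardα : ∀ y, (S y).card ≤ (S (y + α)).card := by
    intro y
    rw [← Finset.card_image_of_injective (S y) (add_left_injective (f y))]
    exact Finset.card_le_card (hforward y)
  have hcardn : ∀ y (n : ℕ), (S y).card ≤ (S (y + n * α)).card := by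
    intro y n
    induction n with
    | zero => simp
    | succ n ih =>
      refine ih.trans ((hcardα _).trans_eq ?_)
      push_cast
      ring_nf
  obtain ⟨y₀, hy₀⟩ : ∃ y₀, ∀ y, (S y₀).card ≤ (S y).card := by
    obtain ⟨y₀, h⟩ := WellFounded.has_min (measure fun y : ℝ => (S y).card).wf univ univ_nonempty
    exact ⟨y₀, fun y => not_lt.1 (h.2 y (mem_univ y))⟩
  obtain ⟨δ, hδ, hδS⟩ := hsub y₀
  have hSeq : ∀ z, y₀ ≤ z → z < y₀ + δ → S z = S y₀ := fun z h h' =>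
    Finset.eq_of_subset_of_card_le (hδS z h h') (hy₀ z)
  have hcard : ∀ y, (S y).card = (S y₀).card := by
    intro y
    refine le_antisymm ?_ (hy₀ y)
    obtain ⟨n, p, h1, h2⟩ := exists_nat_int_mem_Ico hα y y₀ hδ
    rw [← hSeq _ h1 h2]
    exact (hcardn y n).trans (Finset.card_le_card (hSint _ p))
  have hk : ((S y₀).card : ZMod N) ≠ 0 := by
    rw [Ne, ZMod.natCast_eq_zero_iff]
    refine Nat.not_dvd_of_pos_of_lt (Finset.card_pos.2 (hne y₀)) ?_
    rw [← hcard y₁]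
    refine (Finset.card_lt_univ_of_notMem (x := u₁) ?_).trans_eq (ZMod.card N)
    rw [memS]
    intro h
    obtain ⟨n, p, h1, h2, h3⟩ := h ε₁ hε₁
    exact havoid n p h1 h2 h3
  refine ⟨fun y => ((S y₀).card : ZMod N)⁻¹ * ∑ u ∈ S y, u, y₀, δ, hδ, ?_, ?_, ?_⟩
  · intro z h h'
    simp only [hSeq z h h']
  · intro x
    have : S x = S (x + 1) := by
      refine Finset.eq_of_subset_of_card_le ?_ ?_
      · simpa using hSint x 1
      · rw [hcard, hcard x]
    simp only [this]
  · intro x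
    have : (S x).image (· + f x) = S (x + α) := by
      refine Finset.eq_of_subset_of_card_le (hforward x) ?_
      rw [Finset.card_image_of_injective _ (add_left_injective (f x)), hcard, hcard x]
    simp only [← this]
    rw [Finset.sum_image (fun a _ b _ h => add_left_injective (f x) h), Finset.sum_add_distrib,
      Finset.sum_const, hcard x, nsmul_eq_mul, mul_add, inv_mul_cancel_left₀ hk]

/-- A function that is additively quasi-periodic with respect to `α` and `1`, and constant on some
interval, is periodic. -/
theorem quasiperiods_eq_zero {N : ℕ} {α : ℝ} (hα : Irrational α) {K : ℝ → ZMod N} {a b : ZMod N}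
    (ha : ∀ x, K (x + α) = K x + a) (hb : ∀ x, K (x + 1) = K x + b) {y₀ δ : ℝ} (hδ : 0 < δ)
    (hK : ∀ z, y₀ ≤ z → z < y₀ + δ → K z = K y₀) : a = 0 ∧ b = 0 := by
  have hmul : ∀ (c : ℝ) (d : ZMod N), (∀ x, K (x + c) = K x + d) →
      ∀ (p : ℤ) (x : ℝ), K (x + p * c) = K x + p * d := by
    intro c d h p
    induction p using Int.induction_on with
    | zero => simp
    | succ i ih =>
      intro x
      have := h (x + (i : ℤ) * c)
      rw [ih] at this
      push_cast at this ⊢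
      rw [add_mul, one_mul, ← add_assoc, this]
      ring
    | pred i ih =>
      intro x
      have := h (x + (-(i : ℤ) - 1 : ℤ) * c)
      have h2 : x + (-(i : ℤ) - 1 : ℤ) * c + c = x + (-(i : ℤ) : ℤ) * c := by
        push_cast
        ring
      rw [h2, ih] at this
      rw [← sub_eq_iff_eq_add.2 this]
      push_cast
      ring
  have hpq : ∀ (p q : ℤ) (x : ℝ), K (x + (p * α + q)) = K x + (p * a + q * b) := by
    intro p q x
    have := hmul 1 b hb q (x + p * α)
    rw [hmul α a ha, mul_one] at this
    rw [← add_assoc, this, add_assoc]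
  have hsmall : ∀ p q : ℤ, 0 ≤ p * α + q → p * α + q < δ → (p * a + q * b : ZMod N) = 0 := by
    intro p q h h'
    have := hpq p q y₀
    rwa [hK _ (by linarith) (by linarith), left_eq_add] at this
  obtain ⟨n, p, h1, h2⟩ := exists_nat_int_mem_Ico hα 0 (δ / 2) (half_pos hδ)
  set g : ℝ := (n : ℤ) * α + p with hg
  have hg' : 0 + n * α + p = g := by rw [hg]; push_cast; ring
  rw [hg'] at h1 h2
  have hg0 : 0 < g := by linarith
  have hzero : ((n : ℤ) * a + p * b : ZMod N) = 0 := hsmall n p hg0.le (by linarith)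
  have hall : ∀ r q : ℤ, (r * a + q * b : ZMod N) = 0 := by
    intro r q
    set k : ℤ := ⌊(r * α + q) / g⌋
    have hk1 : k * g ≤ r * α + q := (le_div_iff₀ hg0).1 (Int.floor_le _)
    have hk2 : r * α + q < (k + 1) * g := (div_lt_iff₀ hg0).1 (Int.lt_floor_add_one _)
    have hr : ((r - k * n : ℤ) : ℝ) * α + (q - k * p : ℤ) = r * α + q - k * g := by
      rw [hg]
      push_cast
      ring
    have := hsmall (r - k * n) (q - k * p) (by rw [hr]; linarith) (by rw [hr]; linarith)
    push_cast at this hzero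
    linear_combination this + k * hzero
  exact ⟨by simpa using hall 1 0, by simpa using hall 0 1⟩

/-- `⌊x⌋ - ⌊x - mα⌋` is the coboundary of an integer-valued step function. -/
theorem exists_floor_transfer (α : ℝ) (m : ℤ) :
    ∃ ψ : ℝ → ℤ, (∀ x, ψ (x + α) = ψ x + (⌊x⌋ - ⌊x - m * α⌋)) ∧ (∀ x, ψ (x + 1) = ψ x + m) ∧
      ∀ x, ∀ᶠ η in 𝓝[≥] (0 : ℝ), ψ (x + η) = ψ x := by
  induction m using Int.induction_on with
  | zero => exact ⟨fun _ => 0, by simp, by simp, by simp⟩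
  | succ i ih =>
    obtain ⟨ψ, h1, h2, h3⟩ := ih
    refine ⟨fun x => ψ x + ⌊x - ((i : ℤ) + 1 : ℤ) * α⌋, fun x => ?_, fun x => ?_, fun x => ?_⟩
    · have : x + α - ((i : ℤ) + 1 : ℤ) * α = x - (i : ℤ) * α := by push_cast; ring
      simp only [h1, this]
      ring
    · simp only [h2, add_sub_right_comm x 1, Int.floor_add_one]
      ring
    · filter_upwards [h3 x, eventually_floor_add_eq (x - ((i : ℤ) + 1 : ℤ) * α)] with η e1 e2
      rw [e1, add_sub_right_comm, e2]
  | pred i ih =>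
    obtain ⟨ψ, h1, h2, h3⟩ := ih
    refine ⟨fun x => ψ x - ⌊x - (-(i : ℤ) : ℤ) * α⌋, fun x => ?_, fun x => ?_, fun x => ?_⟩
    · have : x + α - (-(i : ℤ) : ℤ) * α = x - (-(i : ℤ) - 1 : ℤ) * α := by push_cast; ring
      simp only [h1, this]
      ring
    · simp only [h2, add_sub_right_comm x 1, Int.floor_add_one]
      ring
    · filter_upwards [h3 x, eventually_floor_add_eq (x - (-(i : ℤ) : ℤ) * α)] with η e1 e2
      rw [e1, add_sub_right_comm, e2]

theorem arcCount_mul_add (α : ℝ) (m n : ℤ) (x : ℝ) :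
    arcCount (m * α + n) x = ⌊x⌋ - ⌊x - m * α⌋ + n := by
  rw [arcCount, ← sub_sub, Int.floor_sub_intCast]
  ring

theorem eventually_arcCount_sub_eq {β x : ℝ} (hx : ∀ k : ℤ, x ≠ k) (hxβ : ∀ k : ℤ, x - β ≠ k) :
    ∀ᶠ η in 𝓝[>] (0 : ℝ), arcCount β (x - η) = arcCount β x := by
  filter_upwards [eventually_floor_sub_eq hx, eventually_floor_sub_eq hxβ] with η h1 h2
  rw [arcCount, arcCount, h1, sub_right_comm x η β, h2]

theorem eventually_arcCount_intCast_sub {β : ℝ} (k : ℤ) (hxβ : ∀ l : ℤ, (k : ℝ) - β ≠ l) :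
    ∀ᶠ η in 𝓝[>] (0 : ℝ), arcCount β (k - η) = arcCount β k - 1 := by
  filter_upwards [eventually_floor_intCast_sub k, eventually_floor_sub_eq hxβ] with η h1 h2
  rw [arcCount, arcCount, h1, sub_right_comm (k : ℝ) η β, h2, Int.floor_intCast]
  ring

/-- If `β ∉ ℤα + ℤ`, the indicator function of `[0,β)` modulo `N` is not the coboundary of a
function that is constant on some interval. -/
theorem mem_span_of_transfer {N : ℕ} [Fact (1 < N)] {α β : ℝ} (hα : Irrational α)
    {F : ℝ → ZMod N} {y₀ δ : ℝ} (hδ : 0 < δ) (hF : ∀ z, y₀ ≤ z → z < y₀ + δ → F z = F y₀)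
    (hF1 : ∀ x, F (x + 1) = F x) (hFα : ∀ x, F (x + α) = F x + (arcCount β x : ZMod N)) :
    ∃ m n : ℤ, β = m * α + n := by
  by_contra! hβ
  have hsum : ∀ (q : ℕ) (x : ℝ),
      F (x + q * α) = F x + ∑ i ∈ Finset.range q, (arcCount β (x + i * α) : ZMod N) := by
    intro q x
    induction q with
    | zero => simp
    | succ q ih =>
      rw [Finset.sum_range_succ, ← add_assoc, ← ih, ← hFα]
      push_cast
      ring_nf
  have hper : ∀ (x : ℝ) (p : ℤ), F (x + p) = F x := by
    have hp : Function.Periodic F 1 := hF1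
    intro x p
    simpa using hp.int_mul p x
  obtain ⟨j, p, hj1, hj2⟩ := exists_nat_int_mem_Ico hα.neg 0 (y₀ + δ / 2) (half_pos hδ)
  obtain ⟨l, r, hl1, hl2⟩ := exists_nat_int_mem_Ico hα α (y₀ + δ / 2) (half_pos hδ)
  set z : ℝ := 0 + j * -α + p with hz
  set q : ℕ := j + 1 + l with hq
  have hzi : ∀ i : ℕ, z + i * α = ((i : ℤ) - j : ℤ) * α + p := by
    intro i
    rw [hz]
    push_cast
    ring
  have hreturn : z + q * α + (r - p : ℤ) = α + l * α + r := by
    rw [hz, hq]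
    push_cast
    ring
  have hjump : ∀ i ∈ Finset.range q, ∀ᶠ η in 𝓝[>] (0 : ℝ),
      arcCount β (z - η + i * α) = arcCount β (z + i * α) - if i = j then 1 else 0 := by
    intro i _
    have hcomm : ∀ η, z - η + i * α = z + i * α - η := fun η => by ring
    simp only [hcomm]
    have hnotβ : ∀ k : ℤ, z + i * α - β ≠ k := by
      intro k hk
      rw [hzi] at hk
      refine hβ (i - j) (p - k) ?_
      push_cast at hk ⊢
      linarith
    split_ifs with hij
    · have hzp : z + i * α = p := by rw [hzi, hij]; simp
      rw [hzp] at hnotβ ⊢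
      exact eventually_arcCount_intCast_sub p hnotβ
    · simp only [sub_zero]
      refine eventually_arcCount_sub_eq (fun k hk => ?_) hnotβ
      rw [hzi] at hk
      have hne : (i : ℤ) - j ≠ 0 := by omega
      refine (hα.intCast_mul hne).add_intCast p |>.ne_int k ?_
      exact hk
  have hev := (Filter.eventually_all_finset _).2 hjump
  obtain ⟨η, hηsum, hη0, hηδ⟩ :=
    (hev.and (Ioo_mem_nhdsGT (half_pos hδ))).exists
  have hFz : F (z - η) = F z := by
    rw [hF z (by linarith) (by linarith), hF (z - η) (by linarith) (by linarith)]
  have hFq : F (z - η + q * α) = F (z + q * α) := by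
    rw [← hper (z + q * α) (r - p), ← hper (z - η + q * α) (r - p), hreturn,
      show z - η + q * α + (r - p : ℤ) = α + l * α + r - η by rw [← hreturn]; ring,
      hF _ (by linarith) (by linarith), hF (α + l * α + r) (by linarith) (by linarith)]
  rw [hsum, hsum, hFz, add_right_inj] at hFq
  have hdiff : ∑ i ∈ Finset.range q, (arcCount β (z - η + i * α) : ZMod N) =
      ∑ i ∈ Finset.range q, (arcCount β (z + i * α) : ZMod N) - 1 := by
    have hjq : j ∈ Finset.range q := by
      rw [Finset.mem_range]
      omega
    rw [Finset.sum_congr rfl fun i hi => congrArg (Int.cast : ℤ → ZMod N) (hηsum i hi)]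
    simp only [Int.cast_sub, Finset.sum_sub_distrib, Int.cast_ite, Int.cast_one, Int.cast_zero,
      Finset.sum_ite_eq', if_pos hjq]
  rw [hdiff, sub_eq_self] at hFq
  exact one_ne_zero hFq

theorem not_minimalExt_of_dvd {N : ℕ} [Fact (1 < N)] {α β : ℝ} (hβ : β ∈ Ioo (0 : ℝ) 1)
    {m n : ℤ} (hm : (N : ℤ) ∣ m) (hn : (N : ℤ) ∣ n) (hβmn : β = m * α + n) :
    ¬ MinimalExt (rot α) (veechf N β) := by
  intro hmin
  obtain ⟨ψ, h1, h2, h3⟩ := exists_floor_transfer α m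
  have hm0 : (m : ZMod N) = 0 := (ZMod.intCast_zmod_eq_zero_iff_dvd m N).2 hm
  have hn0 : (n : ZMod N) = 0 := (ZMod.intCast_zmod_eq_zero_iff_dvd n N).2 hn
  have hsum : ∀ k : ℕ, ∑ i ∈ Finset.range k, (arcCount β (0 + i * α) : ZMod N) =
      (ψ (0 + k * α) : ZMod N) - (ψ 0 : ZMod N) := by
    intro k
    induction k with
    | zero => simp
    | succ k ih =>
      have hk : 0 + ((k + 1 : ℕ) : ℝ) * α = 0 + k * α + α := by push_cast; ring
      rw [Finset.sum_range_succ, ih, hk, h1, hβmn, arcCount_mul_add]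
      push_cast
      rw [hn0]
      ring
  have hper : ∀ (x : ℝ) (p : ℤ), (ψ (x + p) : ZMod N) = ψ x := by
    have hp : Function.Periodic (fun x => (ψ x : ZMod N)) 1 := fun x => by
      simp only [h2, Int.cast_add, hm0, add_zero]
    intro x p
    simpa using hp.int_mul p x
  obtain ⟨δ', hδ', hψ'⟩ := mem_nhdsGE_iff_exists_Ico_subset.1 (h3 0)
  set δ : ℝ := min δ' 1
  have hδ : 0 < δ := lt_min hδ' one_pos
  have hδ1 : δ ≤ 1 := min_le_right _ _
  have hψ : ∀ z, 0 ≤ z → z < δ → ψ z = ψ 0 := by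
    intro z hz hz'
    have : ψ (0 + z) = ψ 0 := hψ' ⟨hz, hz'.trans_le (min_le_left _ _)⟩
    rwa [zero_add] at this
  obtain ⟨k, hk1, hk2⟩ := hmin 0 ⟨le_rfl, one_pos⟩ 0 (δ / 2) ⟨by linarith, by linarith⟩ 1 (δ / 4)
    (by linarith)
  rw [skew_iterate N α hβ ⟨le_rfl, one_pos⟩] at hk1 hk2
  rw [hsum] at hk2
  simp only [AddCircle.coe_fract] at hk1
  rw [dist_eq_norm, ← AddCircle.coe_sub, UnitAddCircle.norm_eq, abs_lt] at hk1
  set p : ℤ := round (0 + k * α - δ / 2)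
  have hψk : (ψ (0 + k * α) : ZMod N) = ψ 0 := by
    rw [← hper _ (-p), hψ _ (by push_cast; linarith [hk1.1]) (by push_cast; linarith [hk1.2])]
  rw [hψk, sub_self, add_zero] at hk2
  exact zero_ne_one hk2

theorem exists_dvd_of_not_minimalExt {N : ℕ} [Fact N.Prime] {α β : ℝ} (hα : Irrational α)
    (hβ : β ∈ Ioo (0 : ℝ) 1) (hmin : ¬ MinimalExt (rot α) (veechf N β)) :
    ∃ m n : ℤ, (N : ℤ) ∣ m ∧ (N : ℤ) ∣ n ∧ β = m * α + n := by
  have : Fact (1 < N) := ⟨(Fact.out : N.Prime).one_lt⟩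
  unfold MinimalExt at hmin
  push Not at hmin
  obtain ⟨x, hx, s, y, -, u, ε, hε, havoid⟩ := hmin
  obtain ⟨F, y₀, δ, hδ, hF, hF1, hFα⟩ :=
    exists_transfer_of_avoid (N := N) (f := fun x => (arcCount β x : ZMod N)) hα
      (fun x p => by rw [arcCount_add_intCast])
      (fun x => (eventually_arcCount_add_eq β x).mono fun η h => by rw [h])
      (x₀ := x) (y₁ := y) (u₁ := u - s) hε (by
        intro n p h1 h2 h3
        refine havoid n ?_ ?_
        · rw [skew_iterate N α hβ hx]
          simp only [AddCircle.coe_fract]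
          rw [dist_eq_norm, ← AddCircle.coe_sub, UnitAddCircle.norm_eq]
          refine (round_le _ (-p)).trans_lt ?_
          rw [abs_lt]
          push_cast
          exact ⟨by linarith, by linarith⟩
        · rw [skew_iterate N α hβ hx]
          simp only [h3]
          ring)
  obtain ⟨m, n, hβmn⟩ := mem_span_of_transfer hα hδ hF hF1 hFα
  obtain ⟨ψ, h1, h2, h3⟩ := exists_floor_transfer α m
  obtain ⟨δ', hδ', hψ'⟩ := mem_nhdsGE_iff_exists_Ico_subset.1 (h3 y₀)
  have hmn := quasiperiods_eq_zero (N := N) hα (K := fun x => F x - ψ x) (a := n) (b := -m)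
    (y₀ := y₀) (δ := min δ δ') (fun x => ?_) (fun x => ?_) (lt_min hδ hδ') (fun z hz hz' => ?_)
  · refine ⟨m, n, ?_, ?_, hβmn⟩
    · rw [← ZMod.intCast_zmod_eq_zero_iff_dvd]
      exact neg_eq_zero.1 hmn.2
    · rw [← ZMod.intCast_zmod_eq_zero_iff_dvd]
      exact hmn.1
  · simp only [hFα, h1, hβmn, arcCount_mul_add]
    push_cast
    ring
  · simp only [hF1, h2]
    push_cast
    ring
  · have hz1 := min_le_left δ δ'
    have hz2 := min_le_right δ δ'
    have hψz : ψ (y₀ + (z - y₀)) = ψ y₀ := hψ' ⟨by linarith, by linarith⟩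
    rw [add_sub_cancel] at hψz
    simp only [hψz, hF z hz (by linarith)]

/-- Veech's 1969 examples, generalized to `ℤ/Nℤ` for a prime `N`: for irrational
`α, β ∈ (0,1)`, the Veech N-example `T_f` is not minimal iff `β = mα + n` with `N ∣ m`
and `N ∣ n`. -/
theorem veechN_not_minimal_iff
    (N : ℕ) (hN : N.Prime) (α β : ℝ) (hα : α ∈ Ioo (0:ℝ) 1) (hβ : β ∈ Ioo (0:ℝ) 1)
    (hαirr : Irrational α) (hβirr : Irrational β) :
    ¬ MinimalExt (rot α) (veechf N β) ↔
      ∃ m n : ℤ, (N : ℤ) ∣ m ∧ (N : ℤ) ∣ n ∧ β = m * α + n := by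
  have : Fact N.Prime := ⟨hN⟩
  have : Fact (1 < N) := ⟨hN.one_lt⟩
  exact ⟨exists_dvd_of_not_minimalExt hαirr hβ,
    fun ⟨_, _, hm, hn, h⟩ => not_minimalExt_of_dvd hβ hm hn h⟩
end
end

section
/- Let N be a prime number and let α, β ∈ (0,1) both be irrational. Then the variant T_{1−f} of the Veech N-example is NOT minimal if and only if there exist integers m and n, both divisible by N, such that β = mα + n + 1. -/
open Set

noncomputable section

/-- The step function of the variant of the Veech N-example: `1 - f`, i.e. the function
equal to `0` on `[0,β)` and to `1` on `[β,1)`. -/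
def veechg (N : ℕ) (β : ℝ) (x : ℝ) : ZMod N := if x < β then 0 else 1

open Filter Topology Pointwise

/-- The `1`-periodic extension of `veechg N β` to the real line. -/
def veechLift (N : ℕ) (β y : ℝ) : ZMod N := ((⌊y - β⌋ - ⌊y⌋ + 1 : ℤ) : ZMod N)

lemma veechg_fract {N : ℕ} {β : ℝ} (hβ : β ∈ Ioo (0 : ℝ) 1) (w : ℝ) :
    veechg N β (Int.fract w) = veechLift N β w := by
  have h0 := Int.fract_nonneg w
  have h1 := Int.fract_lt_one w
  have h2 := Int.floor_add_fract w
  obtain ⟨hb0, hb1⟩ := hβ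
  unfold veechg veechLift
  split_ifs with h
  · have : ⌊w - β⌋ = ⌊w⌋ - 1 := by
      rw [Int.floor_eq_iff]; push_cast; constructor <;> linarith
    rw [this]; simp
  · have : ⌊w - β⌋ = ⌊w⌋ := by
      rw [Int.floor_eq_iff]; constructor <;> linarith
    rw [this]; simp

lemma veechLift_sub_intCast (N : ℕ) (β y : ℝ) (k : ℤ) :
    veechLift N β (y - k) = veechLift N β y := by
  unfold veechLift
  rw [show y - k - β = y - β - k by ring, Int.floor_sub_intCast, Int.floor_sub_intCast]
  congr 1; ring

lemma eventually_floor_sub_eq_right (y t : ℝ) :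
    ∀ᶠ z in 𝓝[≥] y, ⌊z - t⌋ = ⌊y - t⌋ := by
  have h : Tendsto (fun z : ℝ => z - t) (𝓝[≥] y) (𝓝[≥] (y - t)) :=
    tendsto_nhdsWithin_iff.2 ⟨(continuous_sub_right t).continuousAt.tendsto.mono_left
      nhdsWithin_le_nhds, eventually_mem_nhdsWithin.mono fun z hz => sub_le_sub_right hz t⟩
  exact h.eventually (tendsto_pure.1 (tendsto_floor_right_pure_floor (y - t)))

lemma eventually_floor_eq {y : ℝ} (hy : ∀ k : ℤ, y ≠ k) : ∀ᶠ z in 𝓝 y, ⌊z⌋ = ⌊y⌋ := by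
  have h : (⌊y⌋ : ℝ) < y := lt_of_le_of_ne (Int.floor_le y) (hy _).symm
  filter_upwards [Ioo_mem_nhds h (Int.lt_floor_add_one y)] with z hz
  exact Int.floor_eq_iff.2 ⟨hz.1.le, hz.2⟩

lemma eventually_veechLift_eq_right (N : ℕ) (β y : ℝ) :
    ∀ᶠ z in 𝓝[≥] y, veechLift N β z = veechLift N β y := by
  filter_upwards [eventually_floor_sub_eq_right y β, eventually_floor_sub_eq_right y 0]
    with z h1 h2
  simp only [sub_zero] at h2
  simp [veechLift, h1, h2]

lemma eventually_veechLift_eq (N : ℕ) {β y : ℝ} (h1 : ∀ k : ℤ, y ≠ k)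
    (h2 : ∀ k : ℤ, y - β ≠ k) : ∀ᶠ z in 𝓝 y, veechLift N β z = veechLift N β y := by
  have h3 : ∀ᶠ z in 𝓝 y, ⌊z - β⌋ = ⌊y - β⌋ :=
    (continuous_sub_right β).continuousAt.eventually (eventually_floor_eq h2)
  filter_upwards [eventually_floor_eq h1, h3] with z h4 h5
  simp [veechLift, h4, h5]

/-- Forward orbits of an irrational rotation are dense. -/
lemma Irrational.exists_add_nat_mul_sub_int_mem_Ioo {α : ℝ} (hα : Irrational α) (x : ℝ) {a b : ℝ}
    (hab : a < b) : ∃ (n : ℕ) (k : ℤ), x + n * α - k ∈ Ioo a b := by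
  have hd : DenseRange (fun n : ℕ => n • (α : AddCircle (1 : ℝ))) := by
    rw [← denseRange_zsmul_iff_nsmul]
    exact AddCircle.denseRange_zsmul_coe_iff.2 (by simpa using hα)
  have ho : IsOpen ((fun t : ℝ => (t : AddCircle (1 : ℝ))) '' Ioo (a - x) (b - x)) :=
    QuotientAddGroup.isOpenMap_coe _ isOpen_Ioo
  obtain ⟨n, t, ht, hnt⟩ := hd.exists_mem_open ho
    ((nonempty_Ioo.2 (by linarith)).image _)
  have hnt' : ((t : ℝ) : AddCircle (1 : ℝ)) = ((n * α : ℝ) : AddCircle (1 : ℝ)) := by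
    rw [← nsmul_eq_mul]; exact hnt
  rw [← sub_eq_zero, ← AddCircle.coe_sub, AddCircle.coe_eq_zero_iff] at hnt'
  obtain ⟨k, hk⟩ := hnt'
  rw [zsmul_eq_mul, mul_one] at hk
  exact ⟨n, -k, by push_cast; constructor <;> linarith [ht.1, ht.2]⟩

section Translates

variable {G : Type*} [AddGroup G]

/-- If `F (y + t) = g y +ᵥ F y` and `g` is constant near `y`, then `F` is constant near `y` iff
it is constant near `y + t`. -/
lemma eventually_eq_add_iff {F : ℝ → Set G} {g : ℝ → G} {t y : ℝ}
    (hF : ∀ z, F (z + t) = g z +ᵥ F z) (hg : ∀ᶠ z in 𝓝 y, g z = g y) :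
    (∀ᶠ z in 𝓝 (y + t), F z = F (y + t)) ↔ ∀ᶠ z in 𝓝 y, F z = F y := by
  rw [← map_add_right_nhds, eventually_map]
  refine eventually_congr (hg.mono fun z hz => ?_)
  rw [hF, hF, hz, vadd_left_cancel_iff]

lemma eventually_eq_add_intCast_mul_iff {F : ℝ → Set G} {c : G} {t : ℝ}
    (hF : ∀ z, F (z + t) = c +ᵥ F z) (y : ℝ) (k : ℤ) :
    (∀ᶠ z in 𝓝 (y + k * t), F z = F (y + k * t)) ↔ ∀ᶠ z in 𝓝 y, F z = F y := by
  have step (y : ℝ) := eventually_eq_add_iff (g := fun _ => c) (y := y) hF (by simp)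
  induction k using Int.induction_on with
  | zero => simp
  | succ k ih =>
    rw [show y + ((k + 1 : ℤ) : ℝ) * t = y + ((k : ℤ) : ℝ) * t + t by push_cast; ring]
    exact (step _).trans ih
  | pred k ih =>
    refine Iff.trans ?_ ih
    rw [show y + ((-k : ℤ) : ℝ) * t = y + ((-k - 1 : ℤ) : ℝ) * t + t by push_cast; ring]
    exact (step _).symm

end Translates

lemma ZMod.eq_empty_or_eq_univ_of_vadd_eq_self {p : ℕ} [Fact p.Prime] {A : Set (ZMod p)}
    {t : ZMod p} (ht : t ≠ 0) (h : t +ᵥ A = A) : A = ∅ ∨ A = univ := by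
  have hn (n : ℕ) : (n * t) +ᵥ A = A := by
    induction n with
    | zero => simp
    | succ n ih => rw [Nat.cast_succ, add_one_mul, add_vadd, h, ih]
  refine A.eq_empty_or_nonempty.imp_right fun ⟨u, hu⟩ => eq_univ_of_forall fun v => ?_
  have h1 := hn ((v - u) * t⁻¹).val
  rw [ZMod.natCast_zmod_val, inv_mul_cancel_right₀ ht] at h1
  rw [← h1]
  exact ⟨u, hu, by simp [vadd_eq_add]⟩

/-- The set of limits of `c n` along those times `n` for which `x + n * α` approaches `y` modulo
`1` from the right. -/
def rightLimits {N : ℕ} (α x : ℝ) (c : ℕ → ZMod N) (y : ℝ) : Set (ZMod N) :=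
  {u | ∀ ε > 0, ∀ M : ℕ, ∃ n ≥ M, ∃ k : ℤ, x + n * α - k ∈ Ico y (y + ε) ∧ c n = u}

section RightLimits

variable {N : ℕ} {α β x : ℝ} {c : ℕ → ZMod N}

lemma rightLimits_add_one (y : ℝ) :
    rightLimits α x c (y + 1) = rightLimits α x c y := by
  ext u
  refine ⟨fun h ε hε M => ?_, fun h ε hε M => ?_⟩
  all_goals obtain ⟨n, hn, k, hk, hu⟩ := h ε hε M
  · exact ⟨n, hn, k + 1, by push_cast; constructor <;> linarith [hk.1, hk.2], hu⟩
  · exact ⟨n, hn, k - 1, by push_cast; constructor <;> linarith [hk.1, hk.2], hu⟩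

lemma rightLimits_add (hc : ∀ n : ℕ, c (n + 1) = c n + veechLift N β (x + n * α)) (y : ℝ) :
    rightLimits α x c (y + α) = veechLift N β y +ᵥ rightLimits α x c y := by
  obtain ⟨δ, hδ, hy⟩ := mem_nhdsGE_iff_exists_Ico_subset.1 (eventually_veechLift_eq_right N β y)
  rw [mem_Ioi] at hδ
  have hy' (n : ℕ) (k : ℤ) (h : x + n * α - k ∈ Ico y δ) :
      c (n + 1) = c n + veechLift N β y := by
    rw [hc, ← veechLift_sub_intCast N β _ k, show veechLift N β _ = _ from hy h]
  ext u
  rw [mem_vadd_set]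
  constructor
  · intro h
    refine ⟨-veechLift N β y + u, fun ε hε M => ?_, by simp [vadd_eq_add]⟩
    obtain ⟨n, hn, k, hk, hu⟩ := h (min ε (δ - y)) (lt_min hε (by linarith)) (M + 1)
    obtain ⟨n, rfl⟩ : ∃ n', n = n' + 1 := ⟨n - 1, by omega⟩
    have h1 := min_le_left ε (δ - y)
    have h2 := min_le_right ε (δ - y)
    push_cast at hk
    refine ⟨n, by omega, k, by constructor <;> linarith [hk.1, hk.2], ?_⟩
    rw [← hu, hy' n k (by constructor <;> linarith [hk.1, hk.2])]
    ring
  · rintro ⟨v, hv, rfl⟩ ε hε M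
    obtain ⟨n, hn, k, hk, hu⟩ := hv (min ε (δ - y)) (lt_min hε (by linarith)) M
    have h1 := min_le_left ε (δ - y)
    have h2 := min_le_right ε (δ - y)
    refine ⟨n + 1, by omega, k, by push_cast; constructor <;> linarith [hk.1, hk.2], ?_⟩
    rw [hy' n k ⟨hk.1, by linarith [hk.2]⟩, hu, vadd_eq_add, add_comm]

lemma eventually_notMem_rightLimits {y : ℝ} {u : ZMod N} (hu : u ∉ rightLimits α x c y) :
    ∀ᶠ z in 𝓝[>] y, u ∉ rightLimits α x c z := by
  simp only [rightLimits, mem_ofPred_eq, not_forall] at hu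
  obtain ⟨ε, hε, M, h⟩ := hu
  filter_upwards [Ioo_mem_nhdsGT (show y < y + ε by linarith)] with z hz hz'
  obtain ⟨n, hn, k, hk, hc⟩ := hz' (y + ε - z) (by linarith [hz.2]) M
  exact h ⟨n, hn, k, by constructor <;> linarith [hk.1, hk.2, hz.1], hc⟩

lemma rightLimits_nonempty [NeZero N] (hα : Irrational α) (y : ℝ) :
    (rightLimits α x c y).Nonempty := by
  by_contra hne
  have h (u : ZMod N) : u ∉ rightLimits α x c y := fun hu => hne ⟨u, hu⟩
  simp only [rightLimits, mem_ofPred_eq, not_forall] at h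
  choose ε hε M hM using h
  obtain ⟨u₀, hu₀⟩ := Finite.exists_min ε
  obtain ⟨u₁, hu₁⟩ := Finite.exists_max M
  obtain ⟨n, k, hk⟩ := hα.exists_add_nat_mul_sub_int_mem_Ioo (x + M u₁ * α)
    (show y < y + ε u₀ by linarith [hε u₀])
  refine hM (c (n + M u₁)) ⟨n + M u₁, ?_, k, ?_, rfl⟩
  · exact (hu₁ _).trans (Nat.le_add_left _ _)
  · push_cast
    constructor <;> linarith [hk.1, hk.2, hu₀ (c (n + M u₁))]

end RightLimits

/-- A `1`-periodic equivariant family is determined, up to translation, by its values on an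
interval. -/
lemma exists_mem_Ioo_eq_vadd {G : Type*} [AddGroup G] {α : ℝ} {A : ℝ → Set G} {g : ℝ → G}
    (hα : Irrational α) (h1 : Function.Periodic A 1) (hA : ∀ y, A (y + α) = g y +ᵥ A y)
    {a b : ℝ} (hab : a < b) (y : ℝ) : ∃ z ∈ Ioo a b, ∃ t : G, A z = t +ᵥ A y := by
  obtain ⟨n, k, hk⟩ := hα.exists_add_nat_mul_sub_int_mem_Ioo y hab
  have hn (n : ℕ) : ∃ t : G, A (y + n * α) = t +ᵥ A y := by
    induction n with
    | zero => exact ⟨0, by simp⟩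
    | succ n ih =>
      obtain ⟨t, ht⟩ := ih
      refine ⟨g (y + n * α) + t, ?_⟩
      rw [add_vadd, ← ht, ← hA]
      push_cast
      ring_nf
  obtain ⟨t, ht⟩ := hn n
  refine ⟨_, hk, t, ?_⟩
  rw [← ht]
  simpa using h1.sub_zsmul_eq k (x := y + n * α)

/-- A right-continuous integer-valued primitive of `y ↦ ⌊y - m * α⌋ - ⌊y⌋` for the rotation by
`α`. -/
lemma exists_floor_primitive (α : ℝ) (m : ℤ) : ∃ h : ℝ → ℤ, (∀ y, h (y + 1) = h y - m) ∧
    (∀ y, h (y + α) - h y = ⌊y - m * α⌋ - ⌊y⌋) ∧ ∀ y, ∀ᶠ z in 𝓝[≥] y, h z = h y := by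
  induction m using Int.induction_on with
  | zero => exact ⟨fun _ => 0, by simp, by simp, by simp⟩
  | succ k ih =>
    obtain ⟨h, h1, h2, h3⟩ := ih
    refine ⟨fun y => h y - ⌊y - ((k + 1 : ℤ) : ℝ) * α⌋, fun y => ?_, fun y => ?_, fun y => ?_⟩
    · dsimp only
      rw [h1, add_sub_right_comm, Int.floor_add_one]
      ring
    · have := h2 y
      dsimp only
      rw [show y + α - ((k + 1 : ℤ) : ℝ) * α = y - ((k : ℤ) : ℝ) * α by push_cast; ring]
      lia
    · filter_upwards [h3 y, eventually_floor_sub_eq_right y (((k + 1 : ℤ) : ℝ) * α)] with z h4 h5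
      rw [h4, h5]
  | pred k ih =>
    obtain ⟨h, h1, h2, h3⟩ := ih
    refine ⟨fun y => h y + ⌊y - ((-k : ℤ) : ℝ) * α⌋, fun y => ?_, fun y => ?_, fun y => ?_⟩
    · dsimp only
      rw [h1, add_sub_right_comm, Int.floor_add_one]
      ring
    · have := h2 y
      dsimp only
      rw [show y + α - ((-k : ℤ) : ℝ) * α = y - ((-k - 1 : ℤ) : ℝ) * α by push_cast; ring]
      lia
    · filter_upwards [h3 y, eventually_floor_sub_eq_right y (((-k : ℤ) : ℝ) * α)] with z h4 h5
      rw [h4, h5]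

lemma veechLift_eq_sub {N : ℕ} {α β : ℝ} {m n : ℤ} (hβ : β = m * α + n + 1) {h : ℝ → ℤ}
    (hh : ∀ y, h (y + α) - h y = ⌊y - m * α⌋ - ⌊y⌋) (y : ℝ) :
    veechLift N β y = h (y + α) - h y - n := by
  unfold veechLift
  rw [← Int.cast_sub, hh, hβ,
    show y - (m * α + n + 1) = y - m * α - ((n + 1 : ℤ) : ℝ) by push_cast; ring,
    Int.floor_sub_intCast]
  push_cast
  ring

section Equivariant

variable {N : ℕ} [Fact N.Prime] {α β : ℝ} {A : ℝ → Set (ZMod N)}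

/-- If an equivariant family of nonempty proper subsets of `ℤ/Nℤ` is constant on some interval,
then the discontinuities `0` and `β` of the cocycle are in the same orbit of the rotation. -/
lemma exists_eq_intCast_mul_add (hα : Irrational α) (hβ : β ∈ Ioo (0 : ℝ) 1)
    (h1 : Function.Periodic A 1) (hA : ∀ y, A (y + α) = veechLift N β y +ᵥ A y)
    (hne : ∀ y, (A y).Nonempty) (huniv : ∀ y, A y ≠ univ) {a b : ℝ} (hab : a < b)
    {S : Set (ZMod N)} (hS : ∀ z ∈ Ioo a b, A z = S) :
    ∃ m n : ℤ, β = m * α + n := by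
  by_contra! hmn
  have hIoo (z : ℝ) (hz : z ∈ Ioo a b) : ∀ᶠ w in 𝓝 z, A w = A z := by
    filter_upwards [Ioo_mem_nhds hz.1 hz.2] with w hw
    rw [hS w hw, hS z hz]
  have hIoo' (y : ℝ) (k : ℤ) (hk : y - k ∈ Ioo a b) : ∀ᶠ w in 𝓝 y, A w = A y := by
    have := eventually_eq_add_intCast_mul_iff (t := 1) (c := 0) (F := A)
      (by simpa using h1) (y - k) k
    rw [mul_one, sub_add_cancel] at this
    exact this.2 (hIoo _ hk)
  have step (j : ℤ) (hj : j ≠ 0) := eventually_eq_add_iff (y := j * α) hA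
    (eventually_veechLift_eq N
      (fun k h => (hα.intCast_mul hj).ne_int k h)
      (fun k h => hmn j (-k) (by push_cast; linarith)))
  have hc1 : ∀ᶠ z in 𝓝 α, A z = A α := by
    by_contra hcon
    obtain ⟨n, k, hk⟩ := hα.exists_add_nat_mul_sub_int_mem_Ioo α hab
    have h (n : ℕ) : ¬ ∀ᶠ z in 𝓝 (α + n * α), A z = A (α + n * α) := by
      induction n with
      | zero => simpa using hcon
      | succ n ih =>
        have h2 := step (n + 1) (by lia)
        push_cast at h2 ⊢
        rw [show ((n : ℝ) + 1) * α = α + n * α by ring] at h2 ⊢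
        rwa [show α + (α + n * α) = α + n * α + α by ring, h2]
    exact h n (hIoo' _ k hk)
  have hc0 : ∀ᶠ z in 𝓝 0, A z = A 0 := by
    by_contra hcon
    obtain ⟨n, k, hk⟩ := hα.neg.exists_add_nat_mul_sub_int_mem_Ioo 0 hab
    have h (n : ℕ) : ¬ ∀ᶠ z in 𝓝 (0 + n * -α), A z = A (0 + n * -α) := by
      induction n with
      | zero => simpa using hcon
      | succ n ih =>
        have h2 := step (-(n + 1)) (by lia)
        push_cast at h2 ⊢
        rw [show -((n : ℝ) + 1) * α + α = 0 + n * -α by ring,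
          show -((n : ℝ) + 1) * α = 0 + (n + 1) * -α by ring] at h2
        rwa [← h2]
    exact h n (hIoo' _ k hk)
  have hc1' : ∀ᶠ z in 𝓝 0, A (z + α) = A α :=
    ((continuous_add_const α).tendsto' 0 α (zero_add α)).eventually hc1
  obtain ⟨z, ⟨h2, h3⟩, h4, h5⟩ := ((hc1'.and hc0).filter_mono nhdsWithin_le_nhds |>.and
    (Ioo_mem_nhdsLT (show max (-1) (β - 1) < 0 by simp [hβ.2]))).exists
  rw [max_lt_iff] at h4
  have e1 : veechLift N β 0 = 0 := by
    have : ⌊-β⌋ = -1 := by rw [Int.floor_eq_iff]; push_cast; constructor <;> linarith [hβ.1, hβ.2]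
    simp [veechLift, this]
  have e2 : veechLift N β z = 1 := by
    have e3 : ⌊z - β⌋ = -1 := by
      rw [Int.floor_eq_iff]; push_cast; constructor <;> linarith [hβ.1, hβ.2]
    have e4 : ⌊z⌋ = -1 := by
      rw [Int.floor_eq_iff]; push_cast; constructor <;> linarith [hβ.1, hβ.2]
    simp [veechLift, e3, e4]
  have e5 := hA 0
  rw [zero_add, e1, zero_vadd] at e5
  rw [hA, e2, h3, e5] at h2
  exact (ZMod.eq_empty_or_eq_univ_of_vadd_eq_self one_ne_zero h2).elim (hne 0).ne_empty (huniv 0)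

/-- If an equivariant family of nonempty proper subsets of `ℤ/Nℤ` is constant on some interval,
then `β = m * α + n + 1` with `m` and `n` divisible by `N`. -/
lemma exists_dvd_eq_intCast_mul_add_one (hα : Irrational α) (hβ : β ∈ Ioo (0 : ℝ) 1)
    (h1 : Function.Periodic A 1) (hA : ∀ y, A (y + α) = veechLift N β y +ᵥ A y)
    (hne : ∀ y, (A y).Nonempty) (huniv : ∀ y, A y ≠ univ) {a b : ℝ} (hab : a < b)
    {S : Set (ZMod N)} (hS : ∀ z ∈ Ioo a b, A z = S) :
    ∃ m n : ℤ, (N : ℤ) ∣ m ∧ (N : ℤ) ∣ n ∧ β = m * α + n + 1 := by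
  obtain ⟨m, n, hmn⟩ := exists_eq_intCast_mul_add hα hβ h1 hA hne huniv hab hS
  obtain ⟨n, rfl⟩ : ∃ n', n = n' + 1 := ⟨n - 1, by ring⟩
  replace hmn : β = m * α + n + 1 := by rw [hmn]; push_cast; ring
  obtain ⟨h, hh1, hhα, hhr⟩ := exists_floor_primitive α m
  set B : ℝ → Set (ZMod N) := fun y => (-(h y : ZMod N)) +ᵥ A y with hB
  have hB1 (y : ℝ) : B (y + 1) = (m : ZMod N) +ᵥ B y := by
    simp only [hB]
    rw [h1, hh1, vadd_vadd]
    push_cast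
    congr 1
    ring
  have hBα (y : ℝ) : B (y + α) = (-n : ZMod N) +ᵥ B y := by
    simp only [hB]
    rw [hA, vadd_vadd, vadd_vadd, veechLift_eq_sub hmn hhα]
    congr 1
    ring
  have hBc : ∃ a' b' : ℝ, a' < b' ∧ ∀ z ∈ Ioo a' b', ∀ᶠ w in 𝓝 z, B w = B z := by
    obtain ⟨c, hc⟩ := exists_between hab
    obtain ⟨d, hd, hcd⟩ := mem_nhdsGE_iff_exists_Ico_subset.1 (hhr c)
    refine ⟨c, min d b, lt_min hd hc.2, fun z hz => ?_⟩
    have hz' (w : ℝ) (hw : w ∈ Ioo c (min d b)) : B w = (-(h c : ZMod N)) +ᵥ S := by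
      simp only [hB]
      rw [hS w ⟨hc.1.trans hw.1, hw.2.trans_le (min_le_right _ _)⟩,
        show h w = h c from hcd ⟨hw.1.le, hw.2.trans_le (min_le_left _ _)⟩]
    filter_upwards [Ioo_mem_nhds hz.1 hz.2] with w hw
    rw [hz' w hw, hz' z hz]
  obtain ⟨a', b', hab', hBc⟩ := hBc
  have hconst : IsLocallyConstant B := (IsLocallyConstant.iff_eventually_eq B).2 fun y => by
    obtain ⟨j, k, hk⟩ := hα.exists_add_nat_mul_sub_int_mem_Ioo y hab'
    have h2 := hBc _ hk
    have h3 := eventually_eq_add_intCast_mul_iff hB1 (y + j * α) (-k)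
    have h4 := eventually_eq_add_intCast_mul_iff hBα y j
    push_cast at h3 h4
    rw [mul_one, ← sub_eq_add_neg] at h3
    exact h4.1 (h3.1 h2)
  have hdvd (t : ℤ) (ht : (t : ZMod N) +ᵥ B 0 = B 0) : (N : ℤ) ∣ t := by
    rw [← ZMod.intCast_zmod_eq_zero_iff_dvd]
    by_contra ht0
    refine (ZMod.eq_empty_or_eq_univ_of_vadd_eq_self ht0 ht).elim ?_ fun h2 => huniv 0 ?_
    · exact ((hne 0).vadd_set).ne_empty
    · rw [eq_univ_iff_forall] at h2 ⊢
      intro u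
      obtain ⟨v, hv, hvu⟩ := h2 (-(h 0 : ZMod N) + u)
      rwa [← add_left_cancel hvu]
  refine ⟨m, n, hdvd m ?_, ?_, hmn⟩
  · rw [← hB1]
    exact hconst.apply_eq_of_preconnectedSpace _ _
  · rw [← dvd_neg]
    refine hdvd (-n) ?_
    push_cast
    rw [← hBα]
    exact hconst.apply_eq_of_preconnectedSpace _ _

end Equivariant

/-- If the values of a lifted orbit near some interval miss a point of `ℤ/Nℤ`, then
`β = m * α + n + 1` with `m` and `n` divisible by `N`. -/
lemma exists_dvd_eq_of_forall_ne {N : ℕ} [Fact N.Prime] {α β x : ℝ} {c : ℕ → ZMod N}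
    (hα : Irrational α) (hβ : β ∈ Ioo (0 : ℝ) 1)
    (hc : ∀ n : ℕ, c (n + 1) = c n + veechLift N β (x + n * α)) {a b : ℝ} (hab : a < b)
    {u : ZMod N} (hu : ∀ (n : ℕ) (k : ℤ), x + n * α - k ∈ Ioo a b → c n ≠ u) :
    ∃ m n : ℤ, (N : ℤ) ∣ m ∧ (N : ℤ) ∣ n ∧ β = m * α + n + 1 := by
  set A := rightLimits α x c
  have h1 : Function.Periodic A 1 := rightLimits_add_one
  have hAα : ∀ y, A (y + α) = veechLift N β y +ᵥ A y := rightLimits_add hc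
  have huniv (y : ℝ) : A y ≠ univ := by
    obtain ⟨z, hz, t, ht⟩ := exists_mem_Ioo_eq_vadd hα h1 hAα hab y
    intro hy
    rw [hy, vadd_set_univ] at ht
    obtain ⟨n, -, k, hk, hn⟩ := eq_univ_iff_forall.1 ht u (b - z) (by linarith [hz.2]) 0
    exact hu n k (by constructor <;> linarith [hk.1, hk.2, hz.1]) hn
  obtain ⟨y, hy⟩ : ∃ y, ∀ z, (A y).ncard ≤ (A z).ncard :=
    ⟨Function.argmin fun y => (A y).ncard, fun z => Function.argmin_le (fun y => (A y).ncard) z⟩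
  have hsub : ∀ᶠ z in 𝓝[>] y, A z = A y := by
    have h2 : ∀ᶠ z in 𝓝[>] y, ∀ v, v ∉ A y → v ∉ A z :=
      eventually_all.2 fun v => by
        by_cases hv : v ∈ A y
        · simp [hv]
        · exact (eventually_notMem_rightLimits hv).mono fun z hz _ => hz
    filter_upwards [h2] with z hz
    exact eq_of_subset_of_ncard_le (fun v hv => by_contra fun h => hz v h hv) (hy z)
  obtain ⟨d, hd, hyd⟩ := mem_nhdsGT_iff_exists_Ioo_subset.1 hsub
  exact exists_dvd_eq_intCast_mul_add_one hα hβ h1 hAα (rightLimits_nonempty hα) huniv hd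
    fun z hz => hyd hz

section Orbit

variable {N : ℕ} {α β x : ℝ} {s : ZMod N}

lemma skew_iterate_fst (f : ℝ → ZMod N) (hx : x ∈ Ico (0 : ℝ) 1) (n : ℕ) :
    ((skew (rot α) f)^[n] (x, s)).1 = Int.fract (x + n * α) := by
  induction n with
  | zero => simpa using (Int.fract_eq_self.2 hx).symm
  | succ n ih =>
    rw [Function.iterate_succ_apply']
    simp only [skew, rot, ih]
    rw [Int.fract_eq_fract]
    refine ⟨-⌊x + n * α⌋, ?_⟩
    have := Int.floor_add_fract (x + n * α)
    push_cast
    linarith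

lemma skew_iterate_succ_snd (hβ : β ∈ Ioo (0 : ℝ) 1) (hx : x ∈ Ico (0 : ℝ) 1) (n : ℕ) :
    ((skew (rot α) (veechg N β))^[n + 1] (x, s)).2 =
      ((skew (rot α) (veechg N β))^[n] (x, s)).2 + veechLift N β (x + n * α) := by
  rw [Function.iterate_succ_apply', ← veechg_fract hβ, ← skew_iterate_fst (veechg N β) hx n]
  rfl

end Orbit

lemma AddCircle.coe_fract_one (w : ℝ) : ((Int.fract w : ℝ) : AddCircle (1 : ℝ)) = w := by
  have := AddCircle.coe_eq_zero_iff (p := (1 : ℝ)) (x := (⌊w⌋ : ℝ)) |>.2 ⟨⌊w⌋, by simp⟩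
  rw [Int.fract, AddCircle.coe_sub, this, sub_zero]

lemma AddCircle.dist_fract_lt_iff (w y ε : ℝ) :
    dist ((Int.fract w : ℝ) : AddCircle (1 : ℝ)) (y : AddCircle (1 : ℝ)) < ε ↔
      ∃ k : ℤ, |w - k - y| < ε := by
  rw [AddCircle.coe_fract_one, dist_eq_norm, ← AddCircle.coe_sub, UnitAddCircle.norm_eq]
  constructor
  · exact fun h => ⟨round (w - y), by rwa [sub_right_comm]⟩
  · rintro ⟨k, hk⟩
    exact (round_le _ k).trans_lt (by rwa [sub_right_comm])

/-- The variant `T_{1-f}` of the Veech N-example, for a prime `N` and irrational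
`α, β ∈ (0,1)`, is not minimal iff `β = mα + n + 1` with `N ∣ m` and `N ∣ n`. -/
theorem veechN_variant_not_minimal_iff
    (N : ℕ) (hN : N.Prime) (α β : ℝ) (hα : α ∈ Ioo (0:ℝ) 1) (hβ : β ∈ Ioo (0:ℝ) 1)
    (hαirr : Irrational α) (hβirr : Irrational β) :
    ¬ MinimalExt (rot α) (veechg N β) ↔
      ∃ m n : ℤ, (N : ℤ) ∣ m ∧ (N : ℤ) ∣ n ∧ β = m * α + n + 1 := by
  have : Fact N.Prime := ⟨hN⟩
  constructor
  · intro h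
    simp only [MinimalExt, not_forall, not_exists, not_and] at h
    obtain ⟨x, hx, s, y, hy, u, ε, hε, h⟩ := h
    refine exists_dvd_eq_of_forall_ne hαirr hβ (skew_iterate_succ_snd (s := s) hβ hx)
      (show y - ε < y + ε by linarith) (u := u) fun n k hk => h n ?_
    rw [skew_iterate_fst _ hx, AddCircle.dist_fract_lt_iff]
    exact ⟨k, abs_lt.2 ⟨by linarith [hk.1], by linarith [hk.2]⟩⟩
  · rintro ⟨m, n, hm, hn, hmn⟩ hmin
    rw [← ZMod.intCast_zmod_eq_zero_iff_dvd] at hm hn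
    obtain ⟨h, h1, h2, h3⟩ := exists_floor_primitive α m
    have hper : Function.Periodic (fun y => (h y : ZMod N)) 1 := fun y => by
      simp [h1, hm]
    have h0 : (0 : ℝ) ∈ Ico (0 : ℝ) 1 := by simp
    have hinv (j : ℕ) : ((skew (rot α) (veechg N β))^[j] (0, 0)).2 =
        (h (0 + j * α) : ZMod N) - h 0 := by
      induction j with
      | zero => simp
      | succ j ih =>
        rw [skew_iterate_succ_snd hβ h0, ih, veechLift_eq_sub hmn h2, hn]
        push_cast
        ring_nf
    obtain ⟨d, hd, hd0⟩ := mem_nhdsGE_iff_exists_Ico_subset.1 (h3 0)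
    rw [mem_Ioi] at hd
    have hd1 := min_le_left d 1
    have hd2 := min_le_right d 1
    have hd3 : 0 < min d 1 := lt_min hd one_pos
    obtain ⟨j, hj, hj'⟩ := hmin 0 h0 0 (min d 1 / 2) ⟨by linarith, by linarith⟩ 1
      (min d 1 / 2) (by linarith)
    rw [skew_iterate_fst _ h0, AddCircle.dist_fract_lt_iff] at hj
    obtain ⟨k, hk⟩ := hj
    rw [abs_lt] at hk
    have h4 : h (0 + j * α - k) = h 0 := hd0 ⟨by linarith, by linarith⟩
    have h5 := hper.sub_zsmul_eq k (x := 0 + j * α)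
    simp only [zsmul_eq_mul, mul_one] at h5
    rw [hinv, ← h5, h4, sub_self] at hj'
    exact zero_ne_one hj'
end
end

section
/- Let N ≥ 2 be an integer and let p be a prime number dividing N. Let α, β ∈ (0,1) both be irrational. If β = mα + n for some integers m and n, both divisible by p, then the Veech N-example T_f is not minimal. -/
open Set

noncomputable section

lemma exists_floor_sub_eq (c : ℝ) : ∃ δ > 0, ∀ x ∈ Ico (0:ℝ) δ, ⌊x - c⌋ = ⌊-c⌋ := by
  refine ⟨⌊-c⌋ + 1 + c, by linarith [Int.lt_floor_add_one (-c)], fun x hx => ?_⟩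
  rw [Int.floor_eq_iff]
  constructor <;> linarith [Int.floor_le (-c), hx.1, hx.2]

/-- The coboundary equation for `x ↦ ⌊x⌋ - ⌊x - mα⌋` under translation by `α` has an
integer-valued solution which is equivariant of degree `m` and constant to the right of `0`. -/
lemma exists_floor_transfer_s2 (α : ℝ) (m : ℤ) : ∃ G : ℝ → ℤ,
    (∀ x, G (x + α) = G x + ⌊x⌋ - ⌊x - m * α⌋) ∧ (∀ x, ∀ k : ℤ, G (x - k) = G x - m * k) ∧
    ∃ δ > 0, ∀ x ∈ Ico (0:ℝ) δ, G x = G 0 := by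
  induction m using Int.induction_on with
  | zero => exact ⟨fun _ => 0, by simp, by simp, 1, one_pos, by simp⟩
  | succ i ih =>
    obtain ⟨G, hα, hk, δ, hδ, hG⟩ := ih
    obtain ⟨δ', hδ', hc⟩ := exists_floor_sub_eq (((i : ℤ) + 1 : ℤ) * α)
    refine ⟨fun x => G x + ⌊x - ((i : ℤ) + 1 : ℤ) * α⌋, fun x => ?_, fun x k => ?_,
      min δ δ', lt_min hδ hδ', fun x hx => ?_⟩
    · have e : x + α - ((i : ℤ) + 1 : ℤ) * α = x - (i : ℤ) * α := by push_cast; ring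
      simp only [hα, e]
      ring
    · have e : x - k - ((i : ℤ) + 1 : ℤ) * α = x - ((i : ℤ) + 1 : ℤ) * α - k := by ring
      simp only [hk, e, Int.floor_sub_intCast]
      ring
    · simp only [hG x ⟨hx.1, hx.2.trans_le (min_le_left _ _)⟩,
        hc x ⟨hx.1, hx.2.trans_le (min_le_right _ _)⟩, zero_sub]
  | pred i ih =>
    obtain ⟨G, hα, hk, δ, hδ, hG⟩ := ih
    obtain ⟨δ', hδ', hc⟩ := exists_floor_sub_eq ((-(i : ℤ) : ℤ) * α)
    refine ⟨fun x => G x - ⌊x - (-(i : ℤ) : ℤ) * α⌋, fun x => ?_, fun x k => ?_,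
      min δ δ', lt_min hδ hδ', fun x hx => ?_⟩
    · have e : x + α - (-(i : ℤ) : ℤ) * α = x - (-(i : ℤ) - 1 : ℤ) * α := by push_cast; ring
      simp only [hα, e]
      ring
    · have e : x - k - (-(i : ℤ) : ℤ) * α = x - (-(i : ℤ) : ℤ) * α - k := by ring
      simp only [hk, e, Int.floor_sub_intCast]
      ring
    · simp only [hG x ⟨hx.1, hx.2.trans_le (min_le_left _ _)⟩,
        hc x ⟨hx.1, hx.2.trans_le (min_le_right _ _)⟩, zero_sub]

lemma veechf_eq_neg_floor (N : ℕ) {β x : ℝ} (hβ : β ∈ Ioo (0:ℝ) 1) (hx : x ∈ Ico (0:ℝ) 1) :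
    veechf N β x = ((-⌊x - β⌋ : ℤ) : ZMod N) := by
  unfold veechf
  split_ifs with h
  · have : ⌊x - β⌋ = -1 := by
      rw [Int.floor_eq_iff]
      push_cast
      constructor <;> linarith [hx.1, hβ.2]
    simp [this]
  · have : ⌊x - β⌋ = 0 := by
      rw [Int.floor_eq_iff]
      push_cast
      constructor <;> linarith [hx.2, hβ.1]
    simp [this]

lemma rot_mem_Ico (α x : ℝ) : rot α x ∈ Ico (0:ℝ) 1 :=
  ⟨Int.fract_nonneg _, Int.fract_lt_one _⟩

/-- A point of `[0,1)` at circle distance less than `r` from `r`, where `2r ≤ 1`,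
lies in `(0,2r)`. -/
lemma mem_Ioo_of_dist_addCircle_lt {z r : ℝ} (hz : z ∈ Ico (0:ℝ) 1) (hr : 2 * r ≤ 1)
    (h : dist (z : AddCircle (1:ℝ)) (r : AddCircle (1:ℝ)) < r) : z ∈ Ioo 0 (2 * r) := by
  rw [dist_eq_norm, ← AddCircle.coe_sub, AddCircle.norm_eq, inv_one, one_mul, mul_one,
    abs_lt] at h
  set k := round (z - r)
  have h1 : (-1 : ℝ) < k := by linarith [hz.1]
  have h2 : (k : ℝ) < 1 := by linarith [hz.2]
  have h3 : -1 < k := by exact_mod_cast h1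
  have h4 : k < 1 := by exact_mod_cast h2
  have h5 : k = 0 := by omega
  rw [h5, Int.cast_zero, sub_zero] at h
  constructor <;> linarith

/-- For an integer `N ≥ 2`, a prime `p` dividing `N`, and irrational `α, β ∈ (0,1)`:
if `β = mα + n` with `p ∣ m` and `p ∣ n`, then the Veech N-example `T_f` is not minimal. -/
theorem veechN_not_minimal_of_prime_divisor
    (N : ℕ) (hN : 2 ≤ N) (p : ℕ) (hp : p.Prime) (hpN : p ∣ N)
    (α β : ℝ) (hα : α ∈ Ioo (0:ℝ) 1) (hβ : β ∈ Ioo (0:ℝ) 1)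
    (hαirr : Irrational α) (hβirr : Irrational β)
    (h : ∃ m n : ℤ, (p : ℤ) ∣ m ∧ (p : ℤ) ∣ n ∧ β = m * α + n) :
    ¬ MinimalExt (rot α) (veechf N β) := by
  obtain ⟨m, n, hm, hn, rfl⟩ := h
  intro hmin
  have : Fact p.Prime := ⟨hp⟩
  obtain ⟨G, hGα, hGk, δ, hδ, hG⟩ := exists_floor_transfer_s2 α m
  have hm' : (m : ZMod p) = 0 := (ZMod.intCast_zmod_eq_zero_iff_dvd m p).2 hm
  have hn' : (n : ZMod p) = 0 := (ZMod.intCast_zmod_eq_zero_iff_dvd n p).2 hn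
  set φ : ZMod N →+* ZMod p := ZMod.castHom hpN (ZMod p)
  have hstep : ∀ x ∈ Ico (0:ℝ) 1,
      φ (veechf N (m * α + n) x) = (G (rot α x) : ZMod p) - G x := by
    intro x hx
    have e : x - (m * α + n) = x - m * α - n := by ring
    have hfl : ⌊x⌋ = 0 := Int.floor_eq_zero_iff.2 hx
    rw [veechf_eq_neg_floor N hβ hx, map_intCast, e, Int.floor_sub_intCast, rot, Int.fract,
      hGk, hGα, hfl]
    push_cast
    rw [hm', hn']
    ring
  have hinv : ∀ k : ℕ, ((skew (rot α) (veechf N (m * α + n)))^[k] (0, 0)).1 ∈ Ico (0:ℝ) 1 ∧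
      φ ((skew (rot α) (veechf N (m * α + n)))^[k] (0, 0)).2 =
        (G ((skew (rot α) (veechf N (m * α + n)))^[k] (0, 0)).1 : ZMod p) - G 0 := by
    intro k
    induction k with
    | zero => simp
    | succ k ih =>
      rw [Function.iterate_succ_apply']
      generalize (skew (rot α) (veechf N (m * α + n)))^[k] (0, 0) = q at ih ⊢
      refine ⟨rot_mem_Ico _ _, ?_⟩
      simp only [skew, map_add, ih.2, hstep q.1 ih.1]
      ring
  have hr : 0 < min δ 1 / 2 := half_pos (lt_min hδ one_pos)
  have hr1 : 2 * (min δ 1 / 2) ≤ 1 := by linarith [min_le_right δ 1]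
  obtain ⟨k, hk, hk1⟩ := hmin 0 (by simp) 0 (min δ 1 / 2) ⟨hr.le, by linarith⟩ 1 _ hr
  obtain ⟨hz, hφ⟩ := hinv k
  have hz' := mem_Ioo_of_dist_addCircle_lt hz hr1 hk
  rw [hk1, hG _ ⟨hz'.1.le, by linarith [hz'.2, min_le_left δ 1]⟩, map_one, sub_self] at hφ
  exact one_ne_zero hφ
end
end

section
/- Let α ∈ (0,1) be irrational, T the rotation of angle α viewed as a 2-interval exchange transformation on [0,1) with discontinuity 1 − α, N ≥ 2 an integer, and T_f the Veech 1969 type extension of T with single marked point ζ₁ and integers a₁, a₂. If ζ₁ = mα − m + 1 for an integer m ≥ 1 with 0 < mα − m + 1 < 1, then T_f is minimal if and only if gcd(N, a₁, m·a₂) = 1. -/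
open Set

noncomputable section

/-- The two-valued step function: `a₁` on `[0,ζ)` and `a₂` on `[ζ,1)` (values in `ℤ/Nℤ`). -/
def twoval (N : ℕ) (ζ : ℝ) (a₁ a₂ : ℤ) (x : ℝ) : ZMod N :=
  if x < ζ then (a₁ : ZMod N) else (a₂ : ZMod N)

/-- The step function `∑_{j=1}^{m} ⌊x - jα⌋`, which up to a constant factor is the transfer function
between the two-valued cocycle and a cocycle depending only on `⌊x + nα⌋`. -/
def floorSum (α : ℝ) (m : ℕ) (x : ℝ) : ℤ :=
  ∑ j ∈ Finset.range m, ⌊x - (j + 1 : ℝ) * α⌋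

theorem floorSum_add_sub (α : ℝ) (m : ℕ) (x : ℝ) (e : ℤ) :
    floorSum α m (x + α - e) = floorSum α m x + ⌊x⌋ - ⌊x - m * α⌋ - m * e := by
  induction m with
  | zero => simp [floorSum]
  | succ k ih =>
    have h : ⌊x + α - e - (k + 1 : ℝ) * α⌋ = ⌊x - k * α⌋ - e := by
      rw [← Int.floor_sub_intCast]
      congr 1
      ring
    simp only [floorSum, Finset.sum_range_succ] at ih ⊢
    rw [ih, h]
    push_cast
    ring

open Filter Topology in
theorem exists_floorSum_eq_right (α : ℝ) (m : ℕ) (y : ℝ) :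
    ∃ δ > 0, ∀ z, y ≤ z → z < y + δ → floorSum α m z = floorSum α m y := by
  have h : ∀ᶠ z in 𝓝[≥] y, ∀ j ∈ Finset.range m,
      ⌊z - (j + 1 : ℝ) * α⌋ = ⌊y - (j + 1 : ℝ) * α⌋ := by
    rw [Filter.eventually_all_finset]
    intro j _
    have ht : Tendsto (fun z : ℝ => z - (j + 1 : ℝ) * α) (𝓝[≥] y)
        (𝓝[≥] (y - (j + 1 : ℝ) * α)) := by
      refine tendsto_nhdsWithin_iff.2 ⟨?_, ?_⟩
      · exact ((continuous_id.sub continuous_const).tendsto y).mono_left nhdsWithin_le_nhds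
      · filter_upwards [self_mem_nhdsWithin] with z hz
        exact sub_le_sub_right (mem_Ici.1 hz) _
    exact tendsto_pure.1 ((tendsto_floor_right_pure_floor _).comp ht)
  obtain ⟨u, hu, hsub⟩ := (mem_nhdsGE_iff_exists_Ico_subset).1 h
  refine ⟨u - y, sub_pos.2 hu, fun z hz hz' => ?_⟩
  exact Finset.sum_congr rfl (hsub ⟨hz, by linarith⟩)

theorem twoval_eq_floor {N : ℕ} {ζ x : ℝ} (hζ : ζ ∈ Ioo (0 : ℝ) 1) (hx : x ∈ Ico (0 : ℝ) 1)
    (a₁ a₂ : ℤ) :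
    twoval N ζ a₁ a₂ x = ((a₁ + (a₂ - a₁) * (⌊x - ζ⌋ + 1) : ℤ) : ZMod N) := by
  obtain ⟨h0, h1⟩ := hζ
  obtain ⟨hx0, hx1⟩ := hx
  unfold twoval
  split_ifs with h
  · have : ⌊x - ζ⌋ = -1 := by
      rw [Int.floor_eq_iff]
      constructor <;> push_cast <;> linarith
    simp [this]
  · have : ⌊x - ζ⌋ = 0 := by
      rw [Int.floor_eq_iff]
      constructor <;> push_cast <;> linarith
    simp [this]

theorem skew_rot_twoval_iterate {α ζ : ℝ} {N m : ℕ} (hζ : ζ = (m : ℝ) * α - m + 1)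
    (hζmem : ζ ∈ Ioo (0 : ℝ) 1) (a₁ a₂ : ℤ) {x : ℝ} (hx : x ∈ Ico (0 : ℝ) 1) (s : ZMod N)
    (n : ℕ) :
    (skew (rot α) (twoval N ζ a₁ a₂))^[n] (x, s) =
      (Int.fract (x + n * α), s + (((a₁ + m * (a₂ - a₁)) * n - m * (a₂ - a₁) * ⌊x + n * α⌋ +
        (a₂ - a₁) * (floorSum α m x - floorSum α m (Int.fract (x + n * α))) : ℤ) : ZMod N)) := by
  induction n with
  | zero =>
    simp [Int.fract_eq_self.2 hx, Int.floor_eq_zero_iff.2 hx]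
  | succ n ih =>
    rw [Function.iterate_succ_apply', ih]
    set z := Int.fract (x + n * α) with hz
    have hz1 : z ∈ Ico (0 : ℝ) 1 := ⟨Int.fract_nonneg _, Int.fract_lt_one _⟩
    have hxz : x + ((n + 1 : ℕ) : ℝ) * α = z + α + (⌊x + n * α⌋ : ℤ) := by
      rw [hz, Int.fract]
      push_cast
      ring
    have hstep := floorSum_add_sub α m z ⌊z + α⌋
    rw [Int.floor_eq_zero_iff.2 hz1] at hstep
    have hfl : ⌊z - ζ⌋ = ⌊z - m * α⌋ + m - 1 := by
      rw [hζ, show z - ((m : ℝ) * α - m + 1) = z - m * α + (m : ℤ) - (1 : ℤ) by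
        push_cast; ring, Int.floor_sub_intCast, Int.floor_add_intCast]
    rw [hxz, Int.fract_add_intCast, Int.floor_add_intCast]
    refine Prod.ext rfl ?_
    simp only [skew]
    rw [twoval_eq_floor hζmem hz1, hfl, add_assoc, ← Int.cast_add, Int.fract, hstep]
    congr 2
    push_cast
    ring

theorem Irrational.exists_nat_mul_sub_int_mem_Ioo {α : ℝ} (hα : Irrational α) {a b : ℝ}
    (hab : a < b) : ∃ (k : ℕ) (q : ℤ), k * α - q ∈ Ioo a b := by
  have hd : DenseRange (· • (α : AddCircle (1 : ℝ)) : ℕ → AddCircle (1 : ℝ)) :=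
    denseRange_zsmul_iff_nsmul.1 (AddCircle.denseRange_zsmul_coe_iff.2 (by simpa using hα))
  have hopen : IsOpen ((fun r : ℝ => (r : AddCircle (1 : ℝ))) '' Ioo a b) :=
    QuotientAddGroup.isOpenMap_coe _ isOpen_Ioo
  obtain ⟨k, r, hr, hk⟩ := hd.exists_mem_open hopen ((nonempty_Ioo.2 hab).image _)
  have hk' : ((r : ℝ) : AddCircle (1 : ℝ)) = ((k * α : ℝ) : AddCircle (1 : ℝ)) := by
    simpa using hk
  rw [← sub_eq_zero, ← AddCircle.coe_sub, AddCircle.coe_eq_zero_iff] at hk'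
  obtain ⟨q, hq⟩ := hk'
  rw [zsmul_one] at hq
  refine ⟨k, -q, ?_⟩
  rwa [show k * α - ((-q : ℤ) : ℝ) = r by push_cast; linarith]

theorem exists_nat_int_modEq {N : ℕ} (hN : N ≠ 0) {A C : ℤ}
    (h : ∀ k : ℤ, k ∣ (N : ℤ) → k ∣ A → k ∣ C → IsUnit k) (u : ℤ) :
    ∃ (n : ℕ) (p : ℤ), (N : ℤ) ∣ A * n + C * p - u := by
  have hu := h (Int.gcd (Int.gcd A C) N) (Int.gcd_dvd_right _ _)
    ((Int.gcd_dvd_left _ _).trans (Int.gcd_dvd_left _ _))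
    ((Int.gcd_dvd_left _ _).trans (Int.gcd_dvd_right _ _))
  have h1 : ((Int.gcd (Int.gcd A C) N : ℕ) : ℤ) = 1 := by
    rcases Int.isUnit_iff.1 hu with h | h <;> omega
  have e1 := Int.gcd_eq_gcd_ab (Int.gcd A C) N
  have e2 := Int.gcd_eq_gcd_ab A C
  rw [h1, e2] at e1
  generalize Int.gcdA A C = p, Int.gcdB A C = q at e1
  generalize Int.gcdA _ (N : ℤ) = r, Int.gcdB _ (N : ℤ) = t at e1
  have hpos : (0 : ℤ) ≤ (u * p * r) % N := Int.emod_nonneg _ (by exact_mod_cast hN)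
  refine ⟨((u * p * r) % N).toNat, u * q * r, ?_⟩
  rw [Int.toNat_of_nonneg hpos, Int.emod_def]
  exact ⟨-t * u - A * ((u * p * r) / N), by linear_combination -u * e1⟩

theorem mem_Ioo_of_dist_coe_lt {z r : ℝ} (hr : r ≤ 1 / 2) (hz : z ∈ Ico (0 : ℝ) 1)
    (h : dist (z : AddCircle (1 : ℝ)) (r : AddCircle (1 : ℝ)) < r) : z ∈ Ioo 0 (2 * r) := by
  rw [dist_eq_norm, ← AddCircle.coe_sub, UnitAddCircle.norm_eq, abs_lt] at h
  obtain ⟨h1, h2⟩ := h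
  obtain ⟨h3, h4⟩ := hz
  have k1 : round (z - r) < 1 := by
    have : (round (z - r) : ℝ) < 1 := by linarith
    exact_mod_cast this
  have k2 : -1 < round (z - r) := by
    have : (-1 : ℝ) < round (z - r) := by linarith
    exact_mod_cast this
  have k3 : round (z - r) = 0 := by omega
  rw [k3, Int.cast_zero] at h1 h2
  constructor <;> linarith

theorem dist_coe_addCircle_le (x y : ℝ) :
    dist (x : AddCircle (1 : ℝ)) (y : AddCircle (1 : ℝ)) ≤ |x - y| := by
  rw [dist_eq_norm, ← AddCircle.coe_sub, UnitAddCircle.norm_eq]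
  simpa using round_le (x - y) 0

/-- If `ζ₁ = mα - m + 1` with `m ≥ 1` and `0 < mα - m + 1 < 1`, the extension `T_f` of the rotation by `α` is minimal iff `gcd(N, a₁, m·a₂) = 1`. -/
theorem twoval_minimal_iff_of_eq_mul_alpha_sub
    (α : ℝ) (hα : α ∈ Ioo (0:ℝ) 1) (hirr : Irrational α) (N : ℕ) (hN : 2 ≤ N)
    (m : ℤ) (hm : 1 ≤ m) (a₁ a₂ : ℤ) (ζ : ℝ) (hζ : ζ = (m : ℝ) * α - (m : ℝ) + 1)
    (hζmem : ζ ∈ Ioo (0:ℝ) 1)  :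
    MinimalExt (rot α) (twoval N ζ a₁ a₂) ↔
      ∀ k : ℤ, k ∣ (N : ℤ) → k ∣ a₁ → k ∣ m * a₂ → IsUnit k := by
  obtain ⟨M, rfl⟩ := Int.eq_ofNat_of_zero_le (show 0 ≤ m by omega)
  have hζ' : ζ = (M : ℝ) * α - M + 1 := by simpa using hζ
  constructor
  · intro hmin k hkN hk1 hk2
    obtain ⟨δ, hδ, hconst⟩ := exists_floorSum_eq_right α M 0
    have hr0 : 0 < min δ 1 / 2 := by positivity
    have hr1 : min δ 1 ≤ 1 := min_le_right _ _
    have hr2 : min δ 1 ≤ δ := min_le_left _ _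
    obtain ⟨n, hn, hs⟩ := hmin 0 ⟨le_rfl, one_pos⟩ 0 (min δ 1 / 2) ⟨hr0.le, by linarith⟩ 1
      (min δ 1 / 2) hr0
    rw [skew_rot_twoval_iterate hζ' hζmem a₁ a₂ ⟨le_rfl, one_pos⟩] at hn hs
    have hz := mem_Ioo_of_dist_coe_lt (by linarith)
      ⟨Int.fract_nonneg _, Int.fract_lt_one _⟩ hn
    simp only at hs
    rw [hconst _ hz.1.le (by linarith [hz.2]), sub_self, mul_zero, add_zero, zero_add,
      ← Int.cast_one, ZMod.intCast_eq_intCast_iff_dvd_sub] at hs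
    obtain ⟨c, hc⟩ := hkN.trans hs
    obtain ⟨d₁, hd₁⟩ := hk1
    obtain ⟨d₂, hd₂⟩ := hk2
    refine isUnit_of_dvd_one ⟨c + (d₁ + d₂ - M * d₁) * n -
      (d₂ - M * d₁) * ⌊(0 : ℝ) + n * α⌋, ?_⟩
    linear_combination hc + ((1 - M) * n + M * ⌊(0 : ℝ) + n * α⌋) * hd₁ +
      (n - ⌊(0 : ℝ) + n * α⌋) * hd₂
  · intro h x hx s y hy u ε hε
    have hN0 : N ≠ 0 := by omega
    have hNpos : (0 : ℝ) < N := by exact_mod_cast Nat.pos_of_ne_zero hN0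
    obtain ⟨δ, hδ, hconst⟩ := exists_floorSum_eq_right α M y
    obtain ⟨v, hv⟩ := ZMod.intCast_surjective (u - s)
    obtain ⟨n₀, p₀, hnp⟩ := exists_nat_int_modEq (N := N) (A := a₁ + M * (a₂ - a₁))
      (C := -(M * (a₂ - a₁))) hN0 (fun k hkN hkA hkC => by
        have hk1 : k ∣ a₁ := by
          have := dvd_add hkA hkC
          rwa [add_neg_cancel_right] at this
        refine h k hkN hk1 ?_
        have := dvd_add (dvd_neg.1 hkC) (hk1.mul_left M)
        rwa [show (M : ℤ) * (a₂ - a₁) + M * a₁ = M * a₂ by ring] at this)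
      (v - (a₂ - a₁) * (floorSum α M x - floorSum α M y))
    obtain ⟨η, hη0, hηδ, hηε, hη1⟩ : ∃ η : ℝ, 0 < η ∧ η ≤ δ ∧ η ≤ ε ∧ η ≤ 1 - y :=
      ⟨min δ (min ε (1 - y)), by simp [hδ, hε, hy.2], by simp, by simp, by simp⟩
    obtain ⟨k, q, hkq⟩ := hirr.exists_nat_mul_sub_int_mem_Ioo
      (a := (y - (x + n₀ * α - p₀)) / N) (b := (y + η - (x + n₀ * α - p₀)) / N)
      (by gcongr; linarith)
    obtain ⟨h1, h2⟩ := hkq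
    rw [div_lt_iff₀ hNpos] at h1
    rw [lt_div_iff₀ hNpos] at h2
    have hfloor : ⌊x + ((n₀ + N * k : ℕ) : ℝ) * α⌋ = p₀ + N * q := by
      rw [Int.floor_eq_iff]
      push_cast
      constructor <;> linarith [hy.1]
    have hfract : Int.fract (x + ((n₀ + N * k : ℕ) : ℝ) * α) =
        x + ((n₀ + N * k : ℕ) : ℝ) * α - (p₀ + N * q : ℤ) := by
      rw [Int.fract, hfloor]
    have hlow : y < Int.fract (x + ((n₀ + N * k : ℕ) : ℝ) * α) := by
      rw [hfract]
      push_cast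
      linarith
    have hupp : Int.fract (x + ((n₀ + N * k : ℕ) : ℝ) * α) < y + η := by
      rw [hfract]
      push_cast
      linarith
    refine ⟨n₀ + N * k, ?_, ?_⟩ <;> rw [skew_rot_twoval_iterate hζ' hζmem a₁ a₂ hx]
    · refine (dist_coe_addCircle_le _ _).trans_lt ?_
      rw [abs_lt]
      constructor <;> linarith
    · simp only
      rw [hconst _ hlow.le (by linarith), hfloor, sub_eq_iff_eq_add'.1 hv.symm]
      congr 1
      rw [eq_comm, ZMod.intCast_eq_intCast_iff_dvd_sub]
      obtain ⟨c, hc⟩ := hnp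
      refine ⟨c + (a₁ + M * (a₂ - a₁)) * k - M * (a₂ - a₁) * q, ?_⟩
      push_cast
      linear_combination hc
end
end
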